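/- Let X be a hereditarily Baire space and let E be a perfectly normal subspace of X which is ambiguously 1-embedded in X and such that every closed subspace of E has a countable π-base. Then E is a hereditarily Baire space. -/

import Mathlib

open Set

universe u v

/-- `A` is functionally open in `X`: `A = f⁻¹((0,1])` for some continuous `f : X → [0,1]`. -/
def FunctionallyOpen (X : Type u) [TopologicalSpace X] (A : Set X) : Prop :=
  ∃ f : X → ℝ, Continuous f ∧ (∀ x, f x ∈ Set.Icc (0:ℝ) 1) ∧ A = f ⁻¹' (Set.Ioc 0 1)

/-- `A` is functionally closed in `X`: `A = f⁻¹(0)` for some continuous `f : X → [0,1]`. -/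
def FunctionallyClosed (X : Type u) [TopologicalSpace X] (A : Set X) : Prop :=
  ∃ f : X → ℝ, Continuous f ∧ (∀ x, f x ∈ Set.Icc (0:ℝ) 1) ∧ A = f ⁻¹' {0}

mutual
/-- The `α`'th functionally additive class in `X`. -/
inductive FunAdd (X : Type u) [TopologicalSpace X] : Ordinal.{0} → Set X → Prop where
  | base (A : Set X) : FunctionallyOpen X A → FunAdd X 0 A
  | union (α : Ordinal.{0}) (hα : α ≠ 0) (β : ℕ → Ordinal.{0}) (hβ : ∀ n, β n < α)
      (s : ℕ → Set X) (hs : ∀ n, FunMul X (β n) (s n)) : FunAdd X α (⋃ n, s n)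

/-- The `α`'th functionally multiplicative class in `X`. -/
inductive FunMul (X : Type u) [TopologicalSpace X] : Ordinal.{0} → Set X → Prop where
  | base (A : Set X) : FunctionallyClosed X A → FunMul X 0 A
  | inter (α : Ordinal.{0}) (hα : α ≠ 0) (β : ℕ → Ordinal.{0}) (hβ : ∀ n, β n < α)
      (s : ℕ → Set X) (hs : ∀ n, FunAdd X (β n) (s n)) : FunMul X α (⋂ n, s n)
end

mutual
/-- The `α`'th (ordinary) additive Borel class in `X`. -/
inductive BorelAdd (X : Type u) [TopologicalSpace X] : Ordinal.{0} → Set X → Prop where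
  | base (A : Set X) : IsOpen A → BorelAdd X 0 A
  | union (α : Ordinal.{0}) (hα : α ≠ 0) (β : ℕ → Ordinal.{0}) (hβ : ∀ n, β n < α)
      (s : ℕ → Set X) (hs : ∀ n, BorelMul X (β n) (s n)) : BorelAdd X α (⋃ n, s n)

/-- The `α`'th (ordinary) multiplicative Borel class in `X`. -/
inductive BorelMul (X : Type u) [TopologicalSpace X] : Ordinal.{0} → Set X → Prop where
  | base (A : Set X) : IsClosed A → BorelMul X 0 A
  | inter (α : Ordinal.{0}) (hα : α ≠ 0) (β : ℕ → Ordinal.{0}) (hβ : ∀ n, β n < α)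
      (s : ℕ → Set X) (hs : ∀ n, BorelAdd X (β n) (s n)) : BorelMul X α (⋂ n, s n)
end

/-- A set is functionally ambiguous of class `α` if it belongs to both the `α`'th functionally
additive and the `α`'th functionally multiplicative class. -/
def FunAmbiguous (X : Type u) [TopologicalSpace X] (α : Ordinal.{0}) (A : Set X) : Prop :=
  FunAdd X α A ∧ FunMul X α A

/-- `f ∈ K_α(X,Y)`: for `α = 0` continuity, for `α > 0` preimages of open sets belong to
the `α`'th functionally additive class. -/
def KClass {X : Type u} {Y : Type v} [TopologicalSpace X] [TopologicalSpace Y]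
    (α : Ordinal.{0}) (f : X → Y) : Prop :=
  (α = 0 → Continuous f) ∧ (α ≠ 0 → ∀ V : Set Y, IsOpen V → FunAdd X α (f ⁻¹' V))

/-- `A` and `B` are `α`-separated in `X`. -/
def AlphaSeparated {X : Type u} [TopologicalSpace X] (α : Ordinal.{0}) (A B : Set X) : Prop :=
  ∃ f : X → ℝ, KClass α f ∧ A ⊆ f ⁻¹' {0} ∧ B ⊆ f ⁻¹' {1}

/-- `X` is an `α`-separated space: any two disjoint sets of the `α`'th (ordinary)
multiplicative class are `α`-separated. -/
def AlphaSeparatedSpace (X : Type u) [TopologicalSpace X] (α : Ordinal.{0}) : Prop :=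
  ∀ A B : Set X, BorelMul X α A → BorelMul X α B → Disjoint A B → AlphaSeparated α A B

/-- `E` is `α`-embedded in `X`. -/
def AlphaEmbedded {X : Type u} [TopologicalSpace X] (α : Ordinal.{0}) (E : Set X) : Prop :=
  (∀ A : Set ↥E, FunAdd ↥E α A → ∃ B : Set X, FunAdd X α B ∧ Subtype.val '' A = B ∩ E) ∧
  (∀ A : Set ↥E, FunMul ↥E α A → ∃ B : Set X, FunMul X α B ∧ Subtype.val '' A = B ∩ E)

/-- `E` is ambiguously `α`-embedded in `X`. -/
def AmbiguouslyEmbedded {X : Type u} [TopologicalSpace X] (α : Ordinal.{0}) (E : Set X) : Prop :=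
  ∀ A : Set ↥E, FunAmbiguous ↥E α A →
    ∃ B : Set X, FunAmbiguous X α B ∧ Subtype.val '' A = B ∩ E

/-- The first uncountable ordinal. -/
noncomputable def omega1 : Ordinal.{0} := (Cardinal.aleph 1).ord

/-- `A` is an `F_σ`-set: a countable union of closed sets. -/
def IsFSigma {X : Type u} [TopologicalSpace X] (A : Set X) : Prop :=
  ∃ F : ℕ → Set X, (∀ n, IsClosed (F n)) ∧ A = ⋃ n, F n

/-- A space has a countable π-base. -/
def CountablePiBase (Z : Type v) [TopologicalSpace Z] : Prop :=
  ∃ 𝒰 : Set (Set Z), 𝒰.Countable ∧ (∀ U ∈ 𝒰, IsOpen U ∧ U.Nonempty) ∧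
    ∀ V : Set Z, IsOpen V → V.Nonempty → ∃ U ∈ 𝒰, U ⊆ V

theorem aux_funMul_isGδ {X : Type u} [TopologicalSpace X] {B : Set X} (h : FunMul X 1 B) :
    IsGδ B := by
  generalize h1 : (1 : Ordinal.{0}) = a at h
  cases h with
  | base A hA => exact absurd h1 one_ne_zero
  | inter _ hα β hβ s hs =>
    refine IsGδ.iInter fun n => ?_
    have h0 : β n = 0 := by
      have := hβ n
      rw [← h1] at this
      exact Order.lt_one_iff.mp this
    have h2 := hs n
    generalize β n = b at h0 h2
    generalize s n = t at h2 ⊢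
    cases h2 with
    | base A hA =>
      obtain ⟨f, hf, hI, he⟩ := hA
      have : t = f ⁻¹' Set.Ioi 0 := by
        rw [he]; ext x
        have := hI x
        simp only [Set.mem_preimage, Set.mem_Ioc, Set.mem_Ioi]
        exact ⟨fun h => h.1, fun h => ⟨h, this.2⟩⟩
      rw [this]
      exact (isOpen_Ioi.preimage hf).isGδ
    | union _ hα => exact absurd h0 hα

theorem aux_funAdd_isGδ {X : Type u} [TopologicalSpace X] {B : Set X} (h : FunAdd X 1 B) :
    IsGδ Bᶜ := by
  generalize h1 : (1 : Ordinal.{0}) = a at h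
  cases h with
  | base A hA => exact absurd h1 one_ne_zero
  | union _ hα β hβ s hs =>
    rw [Set.compl_iUnion]
    refine IsGδ.iInter fun n => ?_
    have h0 : β n = 0 := by
      have := hβ n
      rw [← h1] at this
      exact Order.lt_one_iff.mp this
    have h2 := hs n
    generalize β n = b at h0 h2
    generalize s n = t at h2 ⊢
    cases h2 with
    | base A hA =>
      obtain ⟨f, hf, hI, he⟩ := hA
      rw [he]
      exact (isClosed_singleton.preimage hf).isOpen_compl.isGδ
    | inter _ hα => exact absurd h0 hα

theorem aux_funClosed {Y : Type u} [TopologicalSpace Y] [PerfectlyNormalSpace Y] {A : Set Y}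
    (hA : IsClosed A) : FunctionallyClosed Y A := by
  obtain ⟨f, hf, hI⟩ := (perfectlyNormalSpace_iff_forall_isClosed_preimage_zero).1 ‹_› A hA
  exact ⟨f, f.continuous, hI, hf⟩

theorem aux_funOpen {Y : Type u} [TopologicalSpace Y] [PerfectlyNormalSpace Y] {A : Set Y}
    (hA : IsOpen A) : FunctionallyOpen Y A := by
  obtain ⟨f, hf, hI, he⟩ := aux_funClosed hA.isClosed_compl
  refine ⟨f, hf, hI, ?_⟩
  ext x
  have h1 : x ∈ Aᶜ ↔ x ∈ f ⁻¹' {0} := by rw [he]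
  have h2 := hI x
  simp only [Set.mem_compl_iff, Set.mem_preimage, Set.mem_singleton_iff, Set.mem_Ioc] at h1 ⊢
  constructor
  · intro hx
    exact ⟨lt_of_le_of_ne h2.1 (fun h => h1.2 h.symm hx), h2.2⟩
  · intro hx
    by_contra hc
    exact hx.1.ne' (h1.1 hc)

theorem aux_isGδ_funMul {Y : Type u} [TopologicalSpace Y] [PerfectlyNormalSpace Y] {A : Set Y}
    (hA : IsGδ A) : FunMul Y 1 A := by
  obtain ⟨f, hf, rfl⟩ := hA.eq_iInter_nat
  exact FunMul.inter 1 one_ne_zero (fun _ => 0) (fun _ => zero_lt_one) f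
    (fun n => FunAdd.base _ (aux_funOpen (hf n)))

theorem aux_isGδ_funAdd {Y : Type u} [TopologicalSpace Y] [PerfectlyNormalSpace Y] {A : Set Y}
    (hA : IsGδ Aᶜ) : FunAdd Y 1 A := by
  obtain ⟨f, hf, he⟩ := hA.eq_iInter_nat
  have : A = ⋃ n, (f n)ᶜ := by
    rw [← compl_compl A, he, Set.compl_iInter]
  rw [this]
  exact FunAdd.union 1 one_ne_zero (fun _ => 0) (fun _ => zero_lt_one) _
    (fun n => FunMul.base _ (aux_funClosed (hf n).isClosed_compl))

/-- a non-Baire closed subspace gives a closed meager one -/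
theorem aux_meager {Y : Type u} [TopologicalSpace Y] {C : Set Y}
    (hC : IsClosed C) (h : ¬ BaireSpace ↥C) :
    ∃ (D : Set Y) (A : ℕ → Set Y), IsClosed D ∧ D.Nonempty ∧ (∀ n, IsClosed (A n)) ∧
      Monotone A ∧ (D = ⋃ n, A n) ∧
      ∀ n (W : Set Y), IsOpen W → (W ∩ D).Nonempty → ((W ∩ D) \ A n).Nonempty := by
  have h' : ¬ ∀ f : ℕ → Set ↥C, (∀ n, IsOpen (f n)) → (∀ n, Dense (f n)) → Dense (⋂ n, f n) :=
    fun hh => h ⟨hh⟩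
  push Not at h'
  obtain ⟨f, hfo, hfd, hnd⟩ := h'
  rw [dense_iff_inter_open] at hnd
  push Not at hnd
  obtain ⟨V, hV, hVne, hVe⟩ := hnd
  obtain ⟨V', hV', rfl⟩ := isOpen_induced_iff.1 hV
  choose O hO hOe using fun n => isOpen_induced_iff.1 (hfo n)
  have hfin : ∀ n, Dense (⋂ i ∈ Set.Iic n, f i) := by
    intro n
    have := Set.Finite.dense_sInter (s := f '' Set.Iic n) ((Set.finite_Iic n).image f)
      (by rintro _ ⟨i, _, rfl⟩; exact hfo i) (by rintro _ ⟨i, _, rfl⟩; exact hfd i)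
    rwa [Set.sInter_image] at this
  have hDC : closure (V' ∩ C) ⊆ C := closure_minimal Set.inter_subset_right hC
  refine ⟨closure (V' ∩ C), fun n => closure (V' ∩ C) ∩ (V' ∩ ⋂ i ∈ Set.Iic n, O i)ᶜ,
    isClosed_closure, ?_, ?_, ?_, ?_, ?_⟩
  · obtain ⟨x, hx⟩ := hVne
    exact ⟨x, subset_closure ⟨hx, x.2⟩⟩
  · intro n
    refine isClosed_closure.inter (IsOpen.isClosed_compl ?_)
    exact hV'.inter ((Set.finite_Iic n).isOpen_biInter fun i _ => hO i)
  · rintro m n hmn x ⟨hx, hx2⟩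
    refine ⟨hx, fun h => hx2 ⟨h.1, ?_⟩⟩
    have := h.2
    simp only [Set.mem_iInter, Set.mem_Iic] at this ⊢
    exact fun i hi => this i (hi.trans hmn)
  · ext x
    simp only [Set.mem_iUnion]
    constructor
    · intro hx
      by_contra hc
      push Not at hc
      have h1 : ∀ n, x ∈ V' ∧ x ∈ O n := by
        intro n
        by_contra h2
        refine hc n ⟨hx, fun h3 => h2 ⟨h3.1, ?_⟩⟩
        have := h3.2
        simp only [Set.mem_iInter, Set.mem_Iic] at this
        exact this n le_rfl
      have : (⟨x, hDC hx⟩ : ↥C) ∈ (Subtype.val ⁻¹' V' ∩ ⋂ n, f n : Set ↥C) := by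
        refine ⟨(h1 0).1, Set.mem_iInter.2 fun n => ?_⟩
        rw [← hOe n]
        exact (h1 n).2
      rw [hVe] at this
      exact this
    · rintro ⟨n, hx⟩
      exact hx.1
  · rintro n W hW ⟨x, hxW, hxD⟩
    obtain ⟨y, hyW, hyV, hyC⟩ := mem_closure_iff.1 hxD W hW hxW
    obtain ⟨z, hz1, hz2⟩ := (dense_iff_inter_open.1 (hfin n))
      (Subtype.val ⁻¹' (W ∩ V')) ((hW.inter hV').preimage continuous_subtype_val)
      ⟨⟨y, hyC⟩, hyW, hyV⟩
    refine ⟨z, ⟨hz1.1, subset_closure ⟨hz1.2, z.2⟩⟩, fun h => h.2 ⟨hz1.2, ?_⟩⟩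
    simp only [Set.mem_iInter] at hz2 ⊢
    intro i hi
    have := hz2 i hi
    rw [← hOe i] at this
    exact this

/-- a nonempty meager closed subspace with a countable pi-base is resolved by ambiguous sets -/
theorem aux_split {Y : Type u} [TopologicalSpace Y] [PerfectlyNormalSpace Y] {D : Set Y}
    {A : ℕ → Set Y} (hD : IsClosed D) (hne : D.Nonempty) (hA : ∀ n, IsClosed (A n))
    (hmono : Monotone A) (hU : D = ⋃ n, A n)
    (hnd : ∀ n (W : Set Y), IsOpen W → (W ∩ D).Nonempty → ((W ∩ D) \ A n).Nonempty)
    (hpi : CountablePiBase ↥D) :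
    ∃ S : Set Y, IsGδ S ∧ IsGδ Sᶜ ∧ ∀ W : Set Y, IsOpen W → (W ∩ D).Nonempty →
      (W ∩ D ∩ S).Nonempty ∧ (W ∩ D ∩ Sᶜ).Nonempty := by
  obtain ⟨𝒰, hc, ho, hb⟩ := hpi
  have h𝒰 : 𝒰.Nonempty := by
    obtain ⟨x, hx⟩ := hne
    obtain ⟨U, hU, _⟩ := hb Set.univ isOpen_univ ⟨⟨x, hx⟩, trivial⟩
    exact ⟨U, hU⟩
  obtain ⟨U, rfl⟩ := hc.exists_eq_range h𝒰
  have ho' : ∀ n, IsOpen (U n) := fun n => (ho _ ⟨n, rfl⟩).1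
  choose W hW hWe using fun n => isOpen_induced_iff.1 (ho' n)
  have hWne : ∀ n, (W n ∩ D).Nonempty := by
    intro n
    obtain ⟨x, hx⟩ := (ho _ ⟨n, rfl⟩).2
    rw [← hWe n] at hx
    exact ⟨x, hx, x.2⟩
  have step : ∀ n m, ∃ m', m < m' ∧ ∀ i ≤ n, ((W i ∩ D) ∩ (A m' \ A m)).Nonempty := by
    intro n m
    have : ∀ i, ∃ j, ((W i ∩ D) ∩ (A j \ A m)).Nonempty := by
      intro i
      obtain ⟨x, hx, hxA⟩ := hnd m (W i) (hW i) (hWne i)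
      have h2 := hx.2
      rw [hU] at h2
      obtain ⟨j, hj⟩ := Set.mem_iUnion.1 h2
      exact ⟨j, x, hx, hj, hxA⟩
    choose j hj using this
    refine ⟨m + 1 + (Finset.range (n+1)).sup j, by omega, fun i hi => ?_⟩
    obtain ⟨x, hx, hxj, hxm⟩ := hj i
    refine ⟨x, hx, hmono ?_ hxj, hxm⟩
    have : j i ≤ (Finset.range (n+1)).sup j := Finset.le_sup (by simp; omega)
    omega
  choose g hg1 hg2 using step
  let k : ℕ → ℕ := fun n => Nat.rec 0 (fun n m => g n m) n
  have hk : ∀ n, k (n+1) = g n (k n) := fun n => rfl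
  have hks : StrictMono k := strictMono_nat_of_lt_succ fun n => by rw [hk]; exact hg1 _ _
  have hlay : ∀ n, ∀ i ≤ n, ((W i ∩ D) ∩ (A (k (n+1)) \ A (k n))).Nonempty :=
    fun n => by rw [hk]; exact hg2 _ _
  have hBm : Monotone (fun n => A (k n)) := hmono.comp hks.monotone
  have hkey : ∀ n x, x ∈ A (k (2*n+2)) → x ∉ A (k (2*n+1)) →
      x ∉ ⋃ n, (A (k (2*n+1)) \ A (k (2*n))) := by
    intro n x h1 h2 h3
    obtain ⟨m, hm1, hm2⟩ := Set.mem_iUnion.1 h3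
    rcases le_or_gt m n with h | h
    · exact h2 (hBm (show 2*m+1 ≤ 2*n+1 by omega) hm1)
    · exact hm2 (hBm (show 2*n+2 ≤ 2*m by omega) h1)
  refine ⟨⋃ n, (A (k (2*n+1)) \ A (k (2*n))), ?_, ?_, ?_⟩
  · have : (⋃ n, (A (k (2*n+1)) \ A (k (2*n)))) =
        (D ∩ (A (k 0))ᶜ) ∩ ⋂ n, ((A (k (2*n+2)))ᶜ ∪ A (k (2*n+1))) := by
      ext x
      constructor
      · intro hx
        obtain ⟨m, hm1, hm2⟩ := Set.mem_iUnion.1 hx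
        refine ⟨⟨?_, fun h => hm2 (hBm (Nat.zero_le _) h)⟩, Set.mem_iInter.2 fun n => ?_⟩
        · rw [hU]; exact Set.mem_iUnion.2 ⟨_, hm1⟩
        · by_contra hc
          simp only [Set.mem_union, Set.mem_compl_iff, not_or, not_not] at hc
          exact hkey n x hc.1 hc.2 hx
      · rintro ⟨⟨hxD, hx0⟩, hx⟩
        have hex : ∃ j, x ∈ A (k j) := by
          rw [hU] at hxD
          obtain ⟨j, hj⟩ := Set.mem_iUnion.1 hxD
          exact ⟨j, hmono (hks.id_le j) hj⟩
        classical
        obtain ⟨j, hj, hjm⟩ : ∃ j, x ∈ A (k j) ∧ ∀ i < j, x ∉ A (k i) :=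
          ⟨Nat.find hex, Nat.find_spec hex, fun i hi => Nat.find_min hex hi⟩
        rcases j with _ | j
        · exact absurd hj hx0
        · rcases Nat.even_or_odd' j with ⟨n, rfl | rfl⟩
          · exact Set.mem_iUnion.2 ⟨n, hj, hjm _ (by omega)⟩
          · rcases Set.mem_iInter.1 hx n with h | h
            · exact absurd hj h
            · exact absurd h (hjm (2*n+1) (by omega))
    rw [this]
    exact (hD.isGδ.inter (hA _).isOpen_compl.isGδ).inter
      (IsGδ.iInter fun n => (hA _).isOpen_compl.isGδ.union (hA _).isGδ)
  · rw [Set.compl_iUnion]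
    refine IsGδ.iInter fun n => ?_
    rw [Set.sdiff_eq, Set.compl_inter, compl_compl]
    exact (hA _).isOpen_compl.isGδ.union (hA _).isGδ
  · rintro V hV ⟨x, hxV, hxD⟩
    obtain ⟨_, ⟨i, rfl⟩, hi⟩ := hb (Subtype.val ⁻¹' V) (hV.preimage continuous_subtype_val)
      ⟨⟨x, hxD⟩, hxV⟩
    have hsub : W i ∩ D ⊆ V ∩ D := by
      rintro y ⟨hy, hyD⟩
      have : (⟨y, hyD⟩ : ↥D) ∈ U i := by rw [← hWe i]; exact hy
      exact ⟨hi this, hyD⟩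
    constructor
    · obtain ⟨y, hy, hy2⟩ := hlay (2*i) i (by omega)
      exact ⟨y, hsub hy, Set.mem_iUnion.2 ⟨i, hy2⟩⟩
    · obtain ⟨y, hy, hy2⟩ := hlay (2*i+1) i (by omega)
      exact ⟨y, hsub hy, hkey i y hy2.1 hy2.2⟩

/-- a perfectly normal, ambiguously `1`-embedded subspace `E` of a hereditarily
Baire space, all of whose closed subspaces have countable π-bases, is hereditarily Baire. -/
theorem stmt15 {X : Type u} [TopologicalSpace X]
    (hX : ∀ F : Set X, IsClosed F → BaireSpace ↥F)
    (E : Set X) (hpn : PerfectlyNormalSpace ↥E)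
    (hamb : AmbiguouslyEmbedded 1 E)
    (hpi : ∀ C : Set ↥E, IsClosed C → CountablePiBase ↥C) :
    ∀ C : Set ↥E, IsClosed C → BaireSpace ↥C := by
  intro C hC
  by_contra hnB
  obtain ⟨D, A, hD, hne, hA, hmono, hU, hnd⟩ := aux_meager hC hnB
  obtain ⟨S, hS, hS', hd⟩ := aux_split hD hne hA hmono hU hnd (hpi D hD)
  obtain ⟨B, ⟨hB1, hB2⟩, hBE⟩ := hamb S ⟨aux_isGδ_funAdd hS', aux_isGδ_funMul hS⟩
  have hSB : ∀ x : ↥E, x ∈ S ↔ (x : X) ∈ B := by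
    intro x
    constructor
    · intro hx
      have : (x : X) ∈ B ∩ E := hBE ▸ Set.mem_image_of_mem _ hx
      exact this.1
    · intro hx
      have : (x : X) ∈ Subtype.val '' S := hBE ▸ ⟨hx, x.2⟩
      obtain ⟨y, hy, hyx⟩ := this
      rwa [← Subtype.ext hyx]
  set F : Set X := closure (Subtype.val '' D) with hF
  have := hX F isClosed_closure
  have hdense : ∀ T : Set X, (∀ W : Set ↥E, IsOpen W → (W ∩ D).Nonempty →
      (W ∩ D ∩ Subtype.val ⁻¹' T).Nonempty) → Dense (Subtype.val ⁻¹' T : Set ↥F) := by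
    intro T hT
    rw [dense_iff_inter_open]
    rintro V hV ⟨x, hx⟩
    obtain ⟨V', hV', rfl⟩ := isOpen_induced_iff.1 hV
    obtain ⟨_, hyV, y, hyD, rfl⟩ := mem_closure_iff.1 x.2 V' hV' hx
    obtain ⟨z, ⟨hz1, hz2⟩, hz3⟩ := hT (Subtype.val ⁻¹' V') (hV'.preimage continuous_subtype_val)
      ⟨y, hyV, hyD⟩
    exact ⟨⟨z, subset_closure ⟨z, hz2, rfl⟩⟩, hz1, hz3⟩
  have h1 := hdense B fun W hW hWn => by
    obtain ⟨z, hz, hz2⟩ := (hd W hW hWn).1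
    exact ⟨z, hz, (hSB z).1 hz2⟩
  have h2 := hdense Bᶜ fun W hW hWn => by
    obtain ⟨z, hz, hz2⟩ := (hd W hW hWn).2
    exact ⟨z, hz, fun h => hz2 ((hSB z).2 h)⟩
  have h3 := Dense.inter_of_Gδ ((aux_funMul_isGδ hB2).preimage continuous_subtype_val)
    ((aux_funAdd_isGδ hB1).preimage continuous_subtype_val) h1 h2
  obtain ⟨x, hx⟩ := hne
  have : Nonempty ↥F := ⟨⟨x, subset_closure ⟨x, hx, rfl⟩⟩⟩
  obtain ⟨z, hz1, hz2⟩ := h3.nonempty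
  exact hz2 hz1
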